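/- Let X be a normal projective variety and f : X → X a finite surjective morphism. Then the preimage under f of the non-ℚ-factorial locus NQF(Y) of Y = X is contained in NQF(X); more generally, for a finite surjective morphism f : X → Y of normal varieties, f⁻¹(NQF(Y)) ⊆ NQF(X). -/

import Mathlib

/-!
STATEMENT 15: For a finite surjective morphism `f : X → Y` of normal varieties,
`f⁻¹(NQF(Y)) ⊆ NQF(X)`; in particular this applies to a finite surjective
endomorphism `f : X → X` of a normal projective variety (the case `Y = X`).

Here, for a normal variety `X` and a closed point `x`, `NQF(X)` is the set of points
whose completed local ring `Ô_{X,x}` is not ℚ-factorial, where a local ring is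
ℚ-factorial if every height-one prime `𝔭` satisfies `𝔭 = √(f)` for some `f ∈ 𝔭`.

Formalization notes.  We use Mathlib schemes: varieties are integral schemes, normal
means all stalks are integrally closed domains, the completed local ring at `x` is
the adic completion of the stalk at its maximal ideal, and the height of a prime is
its height in the prime spectrum.
-/

open AlgebraicGeometry

/-- A (local) commutative ring is ℚ-factorial if every height-one prime ideal is the
radical of a principal ideal. -/
def IsQFactorialRing (R : Type*) [CommRing R] : Prop :=
  ∀ p : PrimeSpectrum R, Order.height p = 1 →
    ∃ f ∈ p.asIdeal, p.asIdeal = (Ideal.span {f}).radical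

/-- The completed local ring `Ô_{X,x}` of a scheme at a point. -/
noncomputable abbrev completedStalk (X : Scheme) (x : X) :=
  AdicCompletion (IsLocalRing.maximalIdeal (X.presheaf.stalk x)) (X.presheaf.stalk x)

/-- The non-ℚ-factorial locus of a scheme: points whose completed local ring is not
ℚ-factorial. -/
noncomputable def NQF (X : Scheme) : Set X :=
  {x : X | ¬ IsQFactorialRing (completedStalk X x)}

/-- A scheme is normal if all of its stalks are integrally closed domains. -/
def IsNormalScheme (X : Scheme) : Prop :=
  ∀ x : X, IsDomain (X.presheaf.stalk x) ∧ IsIntegrallyClosed (X.presheaf.stalk x)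


section PartOne
open Polynomial

lemma nqf_val_matrix {V K L : Type*} [CommRing V] [IsDomain V] [ValuationRing V] [Field K]
    [Field L] [Algebra V K] [IsFractionRing V K] [Algebra K L] [Algebra V L] [IsScalarTower V K L]
    [FiniteDimensional K L]
    (W : Subalgebra V L) [Module.Finite V W]
    (hW : ∀ l : L, ∃ v : V, v ≠ 0 ∧ v • l ∈ W) :
    ∃ (n : ℕ) (m : W →ₐ[V] Matrix (Fin n) (Fin n) V), ∀ w : W,
      (Algebra.lmul K L (w : L)).charpoly = ((m w).charpoly).map (algebraMap V K) := by
  classical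
  have hinj : Function.Injective (algebraMap V L) := by
    rw [IsScalarTower.algebraMap_eq V K L]
    exact (algebraMap K L).injective.comp (IsFractionRing.injective V K)
  have : Module.IsTorsionFree V L := by
    exact Module.isTorsionFree_iff_algebraMap_injective.mpr hinj
  have : Module.Flat V W := by
    rw [Module.Flat.flat_iff_torsion_eq_bot_of_isBezout, ← Submodule.isTorsionFree_iff_torsion_eq_bot]
    infer_instance
  have : Module.Free V W := Module.free_of_flat_of_isLocalRing
  let b := Module.finBasis V W
  have hloc : IsLocalization (Algebra.algebraMapSubmonoid W (nonZeroDivisors V)) L := by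
    refine ⟨?_, ?_, ?_⟩
    · rintro ⟨_, v, hv, rfl⟩
      refine IsUnit.mk0 _ ?_
      intro h
      have : algebraMap V L v = 0 := h
      exact nonZeroDivisors.ne_zero hv (hinj (by simpa using this))
    · intro l
      obtain ⟨v, hv, hl⟩ := hW l
      refine ⟨⟨⟨_, hl⟩, ⟨algebraMap V W v, v, mem_nonZeroDivisors_of_ne_zero hv, rfl⟩⟩, ?_⟩
      change l * algebraMap V L v = v • l
      rw [Algebra.smul_def, mul_comm]
    · intro x y h
      refine ⟨1, ?_⟩
      have : x = y := Subtype.ext h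
      rw [this]
  let b' := b.localizationLocalization K (nonZeroDivisors V) L
  refine ⟨_, Algebra.leftMulMatrix b, fun w => ?_⟩
  rw [← LinearMap.charpoly_toMatrix _ b', ← Matrix.charpoly_map]
  congr 1
  exact (Algebra.map_leftMulMatrix_localization V (nonZeroDivisors V) (Rₘ := K) (Sₘ := L) b w).symm

lemma nqf_val_coeff {A B K L : Type*} [CommRing A] [CommRing B] [Field K] [Field L]
    [Algebra A B] [Module.Finite A B] [Algebra A K] [IsDomain B] [Algebra B L] [IsFractionRing B L]
    [IsDomain A] [IsFractionRing A K] [Module.IsTorsionFree A B]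
    [Algebra K L] [Algebra A L] [IsScalarTower A K L] [IsScalarTower A B L]
    [FiniteDimensional K L]
    (V : ValuationSubring K) (hV : (algebraMap A K).range ≤ V.toSubring) :
    (∀ b : B, ∀ i, (Algebra.lmul K L (algebraMap B L b)).charpoly.coeff i ∈ V) ∧
    (∀ (b c : B) (e : A) (i : ℕ), ∃ v ∈ V,
      (Algebra.lmul K L (algebraMap B L (b + e • c))).charpoly.coeff i -
        (Algebra.lmul K L (algebraMap B L b)).charpoly.coeff i = algebraMap A K e * v) := by
  classical
  let : Algebra V L := ((algebraMap K L).comp (algebraMap V K)).toAlgebra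
  have : IsScalarTower V K L := IsScalarTower.of_algebraMap_eq fun _ => rfl
  obtain ⟨s, hs⟩ := (Module.Finite.fg_top : (⊤ : Submodule A B).FG)
  let W : Subalgebra V L := Algebra.adjoin V (algebraMap B L '' s)
  have hsub : ∀ b : B, algebraMap B L b ∈ W := by
    intro b
    have hb : b ∈ Submodule.span A (s : Set B) := hs ▸ Submodule.mem_top
    induction hb using Submodule.span_induction with
    | mem x hx => exact Algebra.subset_adjoin ⟨x, hx, rfl⟩
    | zero => simp
    | add x y _ _ hx hy => rw [map_add]; exact add_mem (hx) (hy)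
    | smul a x _ hx =>
      rw [Algebra.smul_def, map_mul, ← IsScalarTower.algebraMap_apply,
        IsScalarTower.algebraMap_apply A K L]
      exact mul_mem (W.algebraMap_mem (⟨algebraMap A K a, hV ⟨a, rfl⟩⟩ : V)) (hx)
  have : Module.Finite V W := by
    refine Module.Finite.of_fg (N := Subalgebra.toSubmodule W) ?_
    refine fg_adjoin_of_finite ((s.finite_toSet).image _) ?_
    rintro _ ⟨x, -, rfl⟩
    obtain ⟨p, hp, hpx⟩ := Algebra.IsIntegral.isIntegral (R := A) x
    let φ : A →+* V := (algebraMap A K).codRestrict V.toSubring (fun a => hV ⟨a, rfl⟩)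
    refine ⟨p.map φ, hp.map _, ?_⟩
    rw [eval₂_map]
    have : (algebraMap V L).comp φ = (algebraMap B L).comp (algebraMap A B) := by
      ext a
      change algebraMap K L (algebraMap A K a) = algebraMap B L (algebraMap A B a)
      rw [← IsScalarTower.algebraMap_apply, ← IsScalarTower.algebraMap_apply]
    rw [this, ← hom_eval₂, hpx, map_zero]
  have hW : ∀ l : L, ∃ v : V, v ≠ 0 ∧ v • l ∈ W := by
    intro l
    obtain ⟨x, y, hy, rfl⟩ := IsFractionRing.div_surjective (A := B) l
    obtain ⟨a, ha, z, hz⟩ : ∃ a : A, a ≠ 0 ∧ ∃ z, algebraMap A B a = y * z := by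
      have hy0 : y ≠ 0 := nonZeroDivisors.ne_zero hy
      obtain ⟨a, ha, z, hz⟩ := (Algebra.IsIntegral.isIntegral (R := A) y).isAlgebraic.exists_nonzero_dvd
        (mem_nonZeroDivisors_of_ne_zero hy0)
      exact ⟨a, ha, z, hz⟩
    refine ⟨⟨algebraMap A K a, hV ⟨a, rfl⟩⟩, ?_, ?_⟩
    · intro h
      exact ha ((IsFractionRing.injective A K) (by simpa using congrArg Subtype.val h))
    · have hy0 : algebraMap B L y ≠ 0 := by
        simpa using nonZeroDivisors.ne_zero hy
      have : (⟨algebraMap A K a, hV ⟨a, rfl⟩⟩ : V) • (algebraMap B L x / algebraMap B L y)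
          = algebraMap B L (x * z) := by
        rw [Algebra.smul_def]
        change algebraMap K L (algebraMap A K a) * _ = _
        rw [← IsScalarTower.algebraMap_apply, IsScalarTower.algebraMap_apply A B L, hz]
        simp only [map_mul]
        field_simp
      rw [this]
      exact hsub _
  obtain ⟨n, m, hm⟩ := nqf_val_matrix (K := K) W hW
  have hm' : ∀ b : B, (Algebra.lmul K L (algebraMap B L b)).charpoly =
      ((m ⟨_, hsub b⟩).charpoly).map (algebraMap V K) := fun b => hm ⟨_, hsub b⟩
  refine ⟨fun b i => ?_, fun b c e i => ?_⟩
  · rw [hm', coeff_map]; exact Subtype.property _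
  · let e' : V := ⟨algebraMap A K e, hV ⟨e, rfl⟩⟩
    have h1 : (⟨_, hsub (b + e • c)⟩ : W) = ⟨_, hsub b⟩ + e' • ⟨_, hsub c⟩ := by
      apply Subtype.ext
      change algebraMap B L (b + e • c) = algebraMap B L b + e' • algebraMap B L c
      rw [map_add, Algebra.smul_def, map_mul, Algebra.smul_def, ← IsScalarTower.algebraMap_apply,
        IsScalarTower.algebraMap_apply A K L]
      rfl
    have h2 : (m ⟨_, hsub (b + e • c)⟩).charpoly.map (Ideal.Quotient.mk (Ideal.span {e'})) =
        (m ⟨_, hsub b⟩).charpoly.map (Ideal.Quotient.mk (Ideal.span {e'})) := by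
      rw [← Matrix.charpoly_map, ← Matrix.charpoly_map, h1, map_add, map_smul]
      congr 1
      ext i j
      have : Ideal.Quotient.mk (Ideal.span {e'}) e' = 0 :=
        Ideal.Quotient.eq_zero_iff_mem.mpr (Ideal.mem_span_singleton_self _)
      simp [this]
    have h3 := congrArg (fun p => p.coeff i) h2
    simp only [coeff_map] at h3
    rw [Ideal.Quotient.eq, Ideal.mem_span_singleton] at h3
    obtain ⟨v, hv⟩ := h3
    refine ⟨v, v.2, ?_⟩
    rw [hm', hm', coeff_map, coeff_map, ← map_sub, hv, map_mul]
    rfl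

/-- Characteristic polynomial coefficients and norm of a finite extension of a normal domain,
together with their adic continuity. -/
lemma nqf_exists_norm_aux {A B : Type*} (K L : Type*) [CommRing A] [CommRing B] [Field K] [Field L]
    [Algebra A B] [Module.Finite A B] [Algebra A K] [IsDomain B] [Algebra B L] [IsFractionRing B L]
    [IsDomain A] [IsIntegrallyClosed A] [IsFractionRing A K] [Module.IsTorsionFree A B]
    [Algebra K L] [Algebra A L] [IsScalarTower A K L] [IsScalarTower A B L]
    [FiniteDimensional K L] :
    ∃ (d : ℕ) (c : ℕ → B → A) (N : B → A), 0 < d ∧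
      (∀ b : B, b ^ d + ∑ i ∈ Finset.range d, algebraMap A B (c i b) * b ^ i = 0) ∧
      (∀ b, N b = (-1) ^ d * c 0 b) ∧
      (∀ b b', N (b * b') = N b * N b') ∧
      (∀ a, N (algebraMap A B a) = a ^ d) ∧
      (∀ (I : Ideal A) (b b' : B), b - b' ∈ I.map (algebraMap A B) →
        ∀ i, c i b - c i b' ∈ I) := by
  classical
  have hAK := IsFractionRing.injective A K
  have hBL := IsFractionRing.injective B L
  have hmem : ∀ x : K, (∀ V : ValuationSubring K, (algebraMap A K).range ≤ V.toSubring → x ∈ V) →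
      ∃ a, algebraMap A K a = x := by
    intro x hx
    have hcl : IsIntegrallyClosedIn (algebraMap A K).range K := by
      rw [isIntegrallyClosedIn_iff]
      refine ⟨Subtype.val_injective, ?_⟩
      intro x hx
      have : IsIntegral A x := by
        obtain ⟨p, hp, hpx⟩ := hx
        have hs : Function.Surjective (algebraMap A K).rangeRestrict :=
          (algebraMap A K).rangeRestrict_surjective
        obtain ⟨q, hq, -, hqm⟩ := lifts_and_natDegree_eq_and_monic
          (f := (algebraMap A K).rangeRestrict) (p := p)
          (by rw [lifts_iff_coeff_lifts]; exact fun n => hs _) hp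
        refine ⟨q, hqm, ?_⟩
        rw [← hq, eval₂_map] at hpx
        exact hpx
      obtain ⟨y, hy⟩ := IsIntegrallyClosed.isIntegral_iff.mp this
      exact ⟨⟨x, y, hy⟩, rfl⟩
    have := Subring.eq_iInf_of_isIntegrallyClosedIn (R := (algebraMap A K).range)
    have hx' : x ∈ (algebraMap A K).range := by
      rw [this, Subring.mem_iInf]
      rintro ⟨V, hV⟩
      exact hx V hV
    exact hx'
  let χ : B → K[X] := fun b => (Algebra.lmul K L (algebraMap B L b)).charpoly
  have h1 : ∀ (i : ℕ) (b : B), ∃ a, algebraMap A K a = (χ b).coeff i := fun i b =>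
    hmem _ fun V hV => (nqf_val_coeff (L := L) V hV).1 b i
  choose c hc using h1
  have h2 : ∀ (b x : B) (e : A) (i : ℕ), e ∣ c i (b + e • x) - c i b := by
    intro b x e i
    by_cases he : e = 0
    · simp [he]
    have he' : algebraMap A K e ≠ 0 := fun h => he (hAK (by simpa using h))
    obtain ⟨a, ha⟩ := hmem (((χ (b + e • x)).coeff i - (χ b).coeff i) / algebraMap A K e) (by
      intro V hV
      obtain ⟨v, hv, h⟩ := (nqf_val_coeff (L := L) V hV).2 b x e i
      rw [show (χ (b + e • x)).coeff i - (χ b).coeff i = _ from h]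
      rwa [mul_div_cancel_left₀ _ he'])
    refine ⟨a, hAK ?_⟩
    rw [map_sub, map_mul, ha, hc, hc]
    field_simp
  let d := Module.finrank K L
  have hχ : ∀ b, (χ b).Monic := fun b => LinearMap.charpoly_monic _
  have hχd : ∀ b, (χ b).natDegree = d := fun b => LinearMap.charpoly_natDegree _
  have hN : ∀ b, algebraMap A K ((-1) ^ d * c 0 b) = Algebra.norm K (algebraMap B L b) := by
    intro b
    rw [map_mul, hc, Algebra.norm_apply]
    simp only [map_pow, map_neg, map_one]
    exact (LinearMap.det_eq_sign_charpoly_coeff _).symm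
  refine ⟨d, c, fun b => (-1) ^ d * c 0 b, Module.finrank_pos, ?_, fun _ => rfl, ?_, ?_, ?_⟩
  · intro b
    apply hBL
    have := Algebra.aeval_self_charpoly_lmul (R := K) (algebraMap B L b)
    rw [aeval_eq_sum_range, Finset.sum_range_succ] at this
    change ∑ x ∈ Finset.range (χ b).natDegree, (χ b).coeff x • (algebraMap B L b) ^ x +
      (χ b).coeff (χ b).natDegree • (algebraMap B L b) ^ (χ b).natDegree = 0 at this
    rw [(hχ b).coeff_natDegree, hχd] at this
    rw [map_zero, ← this, map_add, add_comm, map_sum, one_smul, map_pow]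
    congr 1
    refine Finset.sum_congr rfl fun i _ => ?_
    rw [← hc, map_mul, ← IsScalarTower.algebraMap_apply, map_pow, Algebra.smul_def,
      ← IsScalarTower.algebraMap_apply]
  · intro b b'
    apply hAK
    have e := (hN (b * b')).trans (by rw [map_mul, map_mul, ← hN, ← hN, ← map_mul])
    exact e
  · intro a
    apply hAK
    rw [hN, ← IsScalarTower.algebraMap_apply, IsScalarTower.algebraMap_apply A K L,
      Algebra.norm_algebraMap, map_pow]
  · intro I b b' h i
    have key : ∀ y ∈ I.map (algebraMap A B), ∀ t b, c i (b + t * y) - c i b ∈ I := by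
      intro y hy
      rw [Ideal.map, Ideal.span] at hy
      induction hy using Submodule.span_induction with
      | mem x hx =>
        obtain ⟨e, he, rfl⟩ := hx
        intro t b
        have := h2 b t e i
        rw [Algebra.smul_def, mul_comm] at this
        exact Ideal.mem_of_dvd _ this he
      | zero => simp
      | add x y _ _ hx hy =>
        intro t b
        have := I.add_mem (hy t (b + t * x)) (hx t b)
        rw [mul_add, ← add_assoc]
        simpa using this
      | smul a x hx ih =>
        intro t b
        rw [smul_eq_mul, ← mul_assoc]
        exact ih _ _
    have := key _ h 1 b'
    simpa using this

attribute [local instance] FractionRing.liftAlgebra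
lemma nqf_exists_norm (A B : Type*) [CommRing A] [CommRing B]
    [Algebra A B] [Module.Finite A B] [IsDomain B]
    [IsDomain A] [IsIntegrallyClosed A] (hinj : Function.Injective (algebraMap A B)) :
    ∃ (d : ℕ) (c : ℕ → B → A) (N : B → A), 0 < d ∧
      (∀ b : B, b ^ d + ∑ i ∈ Finset.range d, algebraMap A B (c i b) * b ^ i = 0) ∧
      (∀ b, N b = (-1) ^ d * c 0 b) ∧
      (∀ b b', N (b * b') = N b * N b') ∧
      (∀ a, N (algebraMap A B a) = a ^ d) ∧
      (∀ (I : Ideal A) (b b' : B), b - b' ∈ I.map (algebraMap A B) →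
        ∀ i, c i b - c i b' ∈ I) := by
  have : Module.IsTorsionFree A B := Module.isTorsionFree_iff_algebraMap_injective.mpr hinj
  have : FaithfulSMul A B := (faithfulSMul_iff_algebraMap_injective A B).mpr hinj
  have : FiniteDimensional (FractionRing A) (FractionRing B) := inferInstance
  exact nqf_exists_norm_aux (FractionRing A) (FractionRing B)

end PartOne


section PartTwo

lemma nqf_descend {R S : Type*} [CommRing R] [CommRing S] (φ : R →+* S) (hφ : φ.IsIntegral)
    (d : ℕ) (N : S → R) (hmul : ∀ s t, N (s * t) = N s * N t)
    (hdvd : ∀ s, s ∣ φ (N s)) (hpow : ∀ r, N (φ r) ∣ r ^ d) (h0 : N 0 = 0)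
    (hS : IsQFactorialRing S) : IsQFactorialRing R := by
  intro p hp
  algebraize [φ]
  have hφ' : ∀ r, φ r = algebraMap R S r := fun _ => rfl
  have hker : ∀ P : PrimeSpectrum R, RingHom.ker (algebraMap R S) ≤ P.asIdeal := by
    intro P r hr
    have h1 := hpow r
    rw [hφ', (RingHom.mem_ker).mp hr, h0, zero_dvd_iff] at h1
    exact P.isPrime.mem_of_pow_mem d (h1 ▸ P.asIdeal.zero_mem)
  obtain ⟨p0, hp0⟩ : ∃ p0, p0 < p := by
    by_contra! h
    have : IsMin p := fun b hb => by
      by_contra hh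
      exact h b (lt_of_le_not_ge hb hh)
    rw [Order.height_eq_zero.mpr this] at hp
    exact zero_ne_one hp
  obtain ⟨q0, -, hq0p, hq0⟩ := Ideal.exists_ideal_over_prime_of_isIntegral (R := R) (S := S)
    p0.asIdeal (⊥ : Ideal S) (hker p0)
  obtain ⟨q, hqle, hqp, hq⟩ := Ideal.exists_ideal_over_prime_of_isIntegral (R := R) (S := S)
    p.asIdeal q0 (by change q0.comap (algebraMap R S) ≤ _; rw [hq0]; exact hp0.le)
  have hqh : Order.height (⟨q, hqp⟩ : PrimeSpectrum S) = 1 := by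
    apply le_antisymm
    · have hmono : StrictMono (PrimeSpectrum.comap (algebraMap R S)) := by
        intro a b hab
        exact Ideal.IsIntegral.comap_lt_comap hab
      have := Order.height_le_height_apply_of_strictMono _ hmono ⟨q, hqp⟩
      have e : PrimeSpectrum.comap (algebraMap R S) ⟨q, hqp⟩ = p := PrimeSpectrum.ext hq
      rwa [e, hp] at this
    · rw [Order.one_le_iff_ne_zero, Ne, Order.height_eq_zero]
      intro hmin
      have : (⟨q, hqp⟩ : PrimeSpectrum S) ≤ ⟨q0, hq0p⟩ := hmin hqle
      have : q ≤ q0 := this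
      have : p.asIdeal ≤ p0.asIdeal := by
        rw [← hq, ← hq0]; exact Ideal.comap_mono this
      exact hp0.not_ge this
  obtain ⟨g, hg, hgq⟩ := hS ⟨q, hqp⟩ hqh
  change q = _ at hgq
  have hf : N g ∈ p.asIdeal := by
    rw [← hq]
    exact q.mem_of_dvd (hdvd g) hg
  refine ⟨N g, hf, le_antisymm ?_ ?_⟩
  · intro r hr
    rw [← hq] at hr
    have hr' : algebraMap R S r ∈ q := hr
    rw [hgq] at hr'
    obtain ⟨n, hn⟩ := hr'
    rw [Ideal.mem_span_singleton] at hn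
    obtain ⟨t, ht⟩ := hn
    refine ⟨n * d, ?_⟩
    rw [Ideal.mem_span_singleton, pow_mul]
    refine dvd_trans ?_ (hpow (r ^ n))
    rw [hφ', map_pow, ht, hmul]
    exact dvd_mul_right _ _
  · rw [Ideal.IsPrime.radical_le_iff p.isPrime, Ideal.span_singleton_le_iff_mem]
    exact hf

end PartTwo


section PartThree

lemma nqf_eval_mono {A : Type*} [CommRing A] (I : Ideal A) (r : AdicCompletion I A) {k l : ℕ}
    (hkl : k ≤ l) (a : A) (h : AdicCompletion.evalₐ I l r = Ideal.Quotient.mk _ a) :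
    AdicCompletion.evalₐ I k r = Ideal.Quotient.mk _ a := by
  obtain ⟨x, rfl⟩ := AdicCompletion.mk_surjective I A r
  rw [AdicCompletion.evalₐ_mk] at h ⊢
  have h1 : (x k - x l : A) ∈ I ^ k := by
    have := x.property hkl
    rw [SModEq.sub_mem] at this
    simpa using this
  rw [Ideal.Quotient.eq] at h ⊢
  have h2 := Ideal.pow_le_pow_right hkl h
  have := (I ^ k).add_mem h1 h2
  simpa using this

lemma nqf_exists_lim {A : Type*} [CommRing A] (I : Ideal A) (f : ℕ → A)
    (hf : ∀ k, f (k + 1) - f k ∈ I ^ k) :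
    ∃ z : AdicCompletion I A, ∀ k, AdicCompletion.evalₐ I k z = Ideal.Quotient.mk _ (f k) := by
  refine ⟨AdicCompletion.mk I A (AdicCompletion.AdicCauchySequence.mk I A f fun n => ?_),
    fun k => ?_⟩
  · apply SModEq.symm
    rw [SModEq.sub_mem]
    simpa using hf n
  · rw [AdicCompletion.evalₐ_mk]; rfl

lemma nqf_complete {A B S : Type*} [CommRing A] [CommRing B] [CommRing S]
    [Algebra A B] [Module.Finite A B] [IsDomain B]
    [IsDomain A] [IsIntegrallyClosed A] (hinj : Function.Injective (algebraMap A B))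
    (m : Ideal A) (n o : Ideal B) (hn : n.comap (algebraMap A B) = m) (hno : n ⊔ o = ⊤)
    (ho : m.map (algebraMap A B) ≤ o) (n0 : ℕ) (hn0 : 0 < n0)
    (hpow : (n * o) ^ n0 ≤ m.map (algebraMap A B))
    (π : ∀ k : ℕ, S →+* B ⧸ n ^ k) (hπinj : ∀ s, (∀ k, π k s = 0) → s = 0)
    (hπ : ∀ (k l : ℕ) (s : S) (b : B), k ≤ l → π l s = Ideal.Quotient.mk _ b →
      π k s = Ideal.Quotient.mk _ b)
    (φ : AdicCompletion m A →+* S)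
    (hφ : ∀ k r a, AdicCompletion.evalₐ m k r = Ideal.Quotient.mk _ a →
      π k (φ r) = Ideal.Quotient.mk _ (algebraMap A B a))
    (hS : IsQFactorialRing S) : IsQFactorialRing (AdicCompletion m A) := by
  classical
  obtain ⟨d, c, N, hd, hroot, hNc, hNmul, hNalg, hcont⟩ := nqf_exists_norm A B hinj
  let M : ℕ → ℕ := fun k => n0 * k
  have hMk : ∀ k, k ≤ M k := fun k => Nat.le_mul_of_pos_left k hn0
  have hMmono : ∀ {k l}, k ≤ l → M k ≤ M l := fun h => Nat.mul_le_mul_left _ h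
  -- closeness
  have hclose : ∀ (k : ℕ) (b b' : B), b - b' ∈ n ^ M k → b - b' ∈ o ^ M k →
      b - b' ∈ (m ^ k).map (algebraMap A B) := by
    intro k b b' h1 h2
    have h3 : b - b' ∈ n ^ M k * o ^ M k := by
      rw [Ideal.mul_eq_inf_of_coprime (Ideal.pow_sup_pow_eq_top hno)]
      exact ⟨h1, h2⟩
    rw [← mul_pow, pow_mul] at h3
    rw [Ideal.map_pow]
    exact Ideal.pow_right_mono hpow k h3
  -- Chinese remainder
  have hcrt : ∀ (k : ℕ) (x y : B), ∃ b, b - x ∈ n ^ M k ∧ b - y ∈ o ^ M k := by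
    intro k x y
    obtain ⟨u, hu, v, hv, huv⟩ := Ideal.isCoprime_iff_exists.mp
      (Ideal.isCoprime_iff_sup_eq.mpr (Ideal.pow_sup_pow_eq_top (m := M k) (n := M k) hno))
    refine ⟨x * v + y * u, ?_, ?_⟩
    · have : x * v + y * u - x = (y - x) * u := by linear_combination x * huv
      rw [this]; exact Ideal.mul_mem_left _ _ hu
    · have : x * v + y * u - y = (x - y) * v := by linear_combination y * huv
      rw [this]; exact Ideal.mul_mem_left _ _ hv
  let Rel : ℕ → S → B → Prop := fun k s b =>
    π (M k) s = Ideal.Quotient.mk _ b ∧ b - 1 ∈ o ^ M k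
  have hex : ∀ k s, ∃ b, Rel k s b := by
    intro k s
    obtain ⟨x, hx⟩ := Ideal.Quotient.mk_surjective (π (M k) s)
    obtain ⟨b, h1, h2⟩ := hcrt k x 1
    exact ⟨b, by rw [← hx, eq_comm, Ideal.Quotient.eq]; exact h1, h2⟩
  have huniq : ∀ k s b b', Rel k s b → Rel k s b' → b - b' ∈ (m ^ k).map (algebraMap A B) := by
    intro k s b b' h h'
    refine hclose k b b' ?_ ?_
    · rw [← Ideal.Quotient.eq, ← h.1, ← h'.1]
    · have := (o ^ M k).sub_mem h.2 h'.2
      simpa using this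
  have hmono : ∀ k l s b, k ≤ l → Rel l s b → Rel k s b := fun k l s b hkl h =>
    ⟨hπ _ _ _ _ (hMmono hkl) h.1, Ideal.pow_le_pow_right (hMmono hkl) h.2⟩
  have hmulrel : ∀ k s t b b', Rel k s b → Rel k t b' → Rel k (s * t) (b * b') := by
    intro k s t b b' h h'
    refine ⟨by rw [map_mul, map_mul, h.1, h'.1], ?_⟩
    have : b * b' - 1 = b * (b' - 1) + (b - 1) := by ring
    rw [this]
    exact add_mem (Ideal.mul_mem_left _ _ h'.2) h.2
  choose h hh using hex
  have hlim : ∀ (i : ℕ) (s : S), ∃ z : AdicCompletion m A, ∀ k,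
      AdicCompletion.evalₐ m k z = Ideal.Quotient.mk _ (c i (h k s)) := by
    intro i s
    refine nqf_exists_lim m _ fun k => ?_
    exact hcont _ _ _ (huniq k s _ _ (hmono _ _ _ _ (Nat.le_succ k) (hh _ _)) (hh _ _)) i
  choose C hC using hlim
  have hCrel : ∀ i s k b, Rel k s b →
      AdicCompletion.evalₐ m k (C i s) = Ideal.Quotient.mk _ (c i b) := by
    intro i s k b hb
    rw [hC, Ideal.Quotient.eq]
    exact hcont _ _ _ (huniq k s _ _ (hh _ _) hb) i
  let NN : S → AdicCompletion m A := fun s => (-1) ^ d * C 0 s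
  have hNNrel : ∀ s k b, Rel k s b →
      AdicCompletion.evalₐ m k (NN s) = Ideal.Quotient.mk _ (N b) := by
    intro s k b hb
    simp only [NN]
    rw [map_mul, hCrel 0 s k b hb, hNc, map_mul]
    simp
  have hNcont : ∀ (I : Ideal A) (b b' : B), b - b' ∈ I.map (algebraMap A B) →
      N b - N b' ∈ I := by
    intro I b b' hb
    rw [hNc, hNc, ← mul_sub]
    exact Ideal.mul_mem_left _ _ (hcont I b b' hb 0)
  have hN1 : N 1 = 1 := by
    have := hNalg 1
    simpa using this
  have hNpow : ∀ b k, N (b ^ k) = N b ^ k := by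
    intro b k
    induction k with
    | zero => simp [hN1]
    | succ k ih => rw [pow_succ, hNmul, ih, pow_succ]
  -- integral equation
  have heq : ∀ s : S, s ^ d + ∑ i ∈ Finset.range d, φ (C i s) * s ^ i = 0 := by
    intro s
    apply hπinj
    intro k
    have e1 : π k s = Ideal.Quotient.mk _ (h k s) := hπ _ _ _ _ (hMk k) (hh k s).1
    have e2 : ∀ i, π k (φ (C i s)) = Ideal.Quotient.mk _ (algebraMap A B (c i (h k s))) :=
      fun i => hφ _ _ _ (hC i s k)
    simp only [map_add, map_sum, map_mul, map_pow, e1, e2]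
    have := congrArg (Ideal.Quotient.mk (n ^ k)) (hroot (h k s))
    simpa only [map_add, map_sum, map_mul, map_pow, map_zero] using this
  have hNm : ∀ b ∈ n, N b ∈ m := by
    intro b hb
    rw [hNc]
    refine Ideal.mul_mem_left _ _ ?_
    rw [← hn, Ideal.mem_comap]
    have h1 := hroot b
    obtain ⟨e, rfl⟩ : ∃ e, d = e + 1 := ⟨d - 1, by omega⟩
    rw [Finset.sum_range_succ'] at h1
    have h2 : algebraMap A B (c 0 b) =
        b * (-(b ^ e) - ∑ i ∈ Finset.range e, algebraMap A B (c (i + 1) b) * b ^ i) := by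
      have h3 : ∑ i ∈ Finset.range e, algebraMap A B (c (i + 1) b) * b ^ (i + 1) =
          b * ∑ i ∈ Finset.range e, algebraMap A B (c (i + 1) b) * b ^ i := by
        rw [Finset.mul_sum]
        exact Finset.sum_congr rfl fun i _ => by ring
      rw [h3] at h1
      linear_combination h1
    rw [h2]
    exact Ideal.mul_mem_right _ _ hb
  refine nqf_descend φ ?_ d NN ?_ ?_ ?_ ?_ hS
  · intro s
    refine ⟨Polynomial.X ^ d + ∑ i ∈ Finset.range d, Polynomial.C (C i s) * Polynomial.X ^ i,
      ?_, ?_⟩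
    · refine Polynomial.monic_X_pow_add ?_
      rw [← Polynomial.mem_degreeLT]
      refine Submodule.sum_mem _ fun i hi => ?_
      rw [Polynomial.mem_degreeLT]
      exact lt_of_le_of_lt (Polynomial.degree_C_mul_X_pow_le _ _)
        (by exact_mod_cast Finset.mem_range.mp hi)
    · have := heq s
      simpa [Polynomial.eval₂_finsetSum] using this
  · intro s t
    refine AdicCompletion.ext_evalₐ fun k => ?_
    rw [hNNrel _ k _ (hmulrel k s t _ _ (hh k s) (hh k t)), hNmul, map_mul, map_mul,
      hNNrel _ k _ (hh k s), hNNrel _ k _ (hh k t)]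
  · intro s
    have h1 := heq s
    obtain ⟨e, he⟩ : ∃ e, d = e + 1 := ⟨d - 1, by omega⟩
    have : s ∣ φ (C 0 s) := by
      rw [he, Finset.sum_range_succ'] at h1
      refine ⟨-(s ^ e) - ∑ i ∈ Finset.range e, φ (C (i + 1) s) * s ^ i, ?_⟩
      have h3 : ∑ i ∈ Finset.range e, φ (C (i + 1) s) * s ^ (i + 1) =
          s * ∑ i ∈ Finset.range e, φ (C (i + 1) s) * s ^ i := by
        rw [Finset.mul_sum]
        exact Finset.sum_congr rfl fun i _ => by ring
      rw [h3] at h1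
      linear_combination h1
    simp only [NN, map_mul]
    exact dvd_mul_of_dvd_right this _
  · intro r
    have hsur : ∀ k, ∃ a, AdicCompletion.evalₐ m (M k) r = Ideal.Quotient.mk _ a := fun k =>
      (Ideal.Quotient.mk_surjective _).imp fun _ h => h.symm
    choose a ha using hsur
    have haa : ∀ k, a (k + 1) - a k ∈ m ^ M k := by
      intro k
      rw [← Ideal.Quotient.eq, ← ha k]
      exact (nqf_eval_mono m r (hMmono (Nat.le_succ k)) _ (ha (k + 1))).symm
    choose b' hb1 hb2 using fun k => hcrt k 1 (algebraMap A B (a k))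
    have hstep : ∀ k, b' (k + 1) - b' k ∈ (m ^ k).map (algebraMap A B) := by
      intro k
      refine hclose k _ _ ?_ ?_
      · have := (n ^ M k).sub_mem (Ideal.pow_le_pow_right (hMmono (Nat.le_succ k)) (hb1 (k + 1)))
          (hb1 k)
        simpa using this
      · have h1 := (o ^ M k).sub_mem
          (Ideal.pow_le_pow_right (hMmono (Nat.le_succ k)) (hb2 (k + 1))) (hb2 k)
        have h2 : algebraMap A B (a (k + 1) - a k) ∈ o ^ M k := by
          have := Ideal.mem_map_of_mem (algebraMap A B) (haa k)
          rw [Ideal.map_pow] at this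
          exact Ideal.pow_right_mono ho _ this
        have := add_mem h1 h2
        rw [map_sub] at this
        convert! this using 1
        ring
    obtain ⟨z, hz⟩ := nqf_exists_lim m (fun k => N (b' k)) fun k => hNcont _ _ _ (hstep k)
    refine ⟨z, ?_⟩
    refine AdicCompletion.ext_evalₐ fun k => ?_
    have hb := hh k (φ r)
    rw [map_mul, hNNrel _ k _ hb, hz, map_pow, nqf_eval_mono m r (hMk k) _ (ha k), ← map_mul,
      ← map_pow, Ideal.Quotient.eq, ← hNmul, ← hNalg]
    refine hNcont _ _ _ ?_
    rw [← neg_mem_iff, neg_sub]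
    have hb3 : h k (φ r) - algebraMap A B (a k) ∈ n ^ M k := by
      rw [← Ideal.Quotient.eq, ← hb.1]
      exact hφ _ _ _ (ha k)
    refine hclose k _ _ ?_ ?_
    · have : h k (φ r) * b' k - algebraMap A B (a k) =
        h k (φ r) * (b' k - 1) + (h k (φ r) - algebraMap A B (a k)) := by ring
      rw [this]
      exact add_mem (Ideal.mul_mem_left _ _ (hb1 k)) hb3
    · have : h k (φ r) * b' k - algebraMap A B (a k) =
        b' k * (h k (φ r) - 1) + (b' k - algebraMap A B (a k)) := by ring
      rw [this]
      exact add_mem (Ideal.mul_mem_left _ _ hb.2) (hb2 k)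
  · refine AdicCompletion.ext_evalₐ fun k => ?_
    obtain ⟨u, hu, v, hv, huv⟩ := Ideal.isCoprime_iff_exists.mp (Ideal.isCoprime_iff_sup_eq.mpr hno)
    obtain ⟨q, hq⟩ : u ^ M k ∣ 1 - (1 - u ^ M k) ^ M k := by
      have := sub_dvd_pow_sub_pow 1 (1 - u ^ M k) (M k)
      simpa using this
    have hrel : Rel k 0 (1 - (1 - u ^ M k) ^ M k) := by
      refine ⟨?_, ?_⟩
      · rw [map_zero, eq_comm, Ideal.Quotient.eq_zero_iff_mem, hq]
        exact Ideal.mul_mem_right _ _ (Ideal.pow_mem_pow hu _)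
      · rw [sub_sub_cancel_left, neg_mem_iff]
        refine Ideal.pow_mem_pow ?_ _
        have : (1 - u) ∣ 1 ^ M k - u ^ M k := sub_dvd_pow_sub_pow _ _ _
        rw [one_pow, show 1 - u = v by linear_combination -huv] at this
        exact Ideal.mem_of_dvd _ this hv
    rw [hNNrel _ k _ hrel, map_zero, Ideal.Quotient.eq_zero_iff_mem, hq, hNmul, hNpow]
    exact Ideal.mul_mem_right _ _ (Ideal.pow_le_pow_right (hMk k) (Ideal.pow_mem_pow (hNm u hu) _))

end PartThree

section PartFour

lemma nqf_artin {Q : Type*} [CommRing Q] [IsArtinianRing Q] (n : Ideal Q) :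
    ∃ (k : ℕ) (e : Q), 0 < k ∧ e ∈ n ∧ n ^ k ≤ Ideal.span {e} ∧ e * (1 - e) = 0 := by
  obtain ⟨k, hk⟩ := IsArtinian.monotone_stabilizes (R := Q) (M := Q)
    ⟨fun i => OrderDual.toDual (n ^ i : Ideal Q), fun _ _ h => Ideal.pow_le_pow_right h⟩
  have hk' : ∀ l, k ≤ l → n ^ k = n ^ l := fun l hl => hk l hl
  have hid : IsIdempotentElem (n ^ (k + 1)) := by
    rw [IsIdempotentElem, ← pow_add, ← hk' _ (by omega : k ≤ k + 1 + (k + 1)),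
      ← hk' _ (by omega : k ≤ k + 1)]
  obtain ⟨e, he, hs⟩ := (Ideal.isIdempotentElem_iff_of_fg _ (IsNoetherian.noetherian _)).mp hid
  refine ⟨k + 1, e, Nat.succ_pos _, ?_, hs.le, ?_⟩
  · have : e ∈ n ^ (k + 1) := by rw [hs]; exact Ideal.mem_span_singleton_self e
    exact Ideal.pow_le_self (Nat.succ_ne_zero k) this
  · rw [mul_sub, mul_one, he.eq, sub_self]

lemma nqf_exists_compl {A B : Type*} [CommRing A] [CommRing B] [Algebra A B] [Module.Finite A B]
    (m : Ideal A) [m.IsMaximal] (n : Ideal B) :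
    ∃ (o : Ideal B) (n0 : ℕ), 0 < n0 ∧ n ⊔ o = ⊤ ∧ m.map (algebraMap A B) ≤ o ∧
      (n * o) ^ n0 ≤ m.map (algebraMap A B) := by
  let := Ideal.Quotient.field m
  have : Module.Finite (A ⧸ m) (B ⧸ m.map (algebraMap A B)) :=
    Module.Finite.of_restrictScalars_finite A _ _
  have : IsArtinianRing (B ⧸ m.map (algebraMap A B)) :=
    IsArtinianRing.of_finite (A ⧸ m) (B ⧸ m.map (algebraMap A B))
  set q := Ideal.Quotient.mk (m.map (algebraMap A B)) with hq
  have hqs : Function.Surjective q := Ideal.Quotient.mk_surjective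
  obtain ⟨k, e, hk, hen, hs, he⟩ := nqf_artin (n.map q)
  refine ⟨(Ideal.span {1 - e}).comap q, k, hk, ?_, ?_, ?_⟩
  · obtain ⟨e0, he0, rfl⟩ := (Ideal.mem_map_iff_of_surjective q hqs).mp hen
    rw [Ideal.eq_top_iff_one, ← add_sub_cancel e0 1]
    refine Submodule.add_mem_sup he0 ?_
    rw [Ideal.mem_comap, map_sub, map_one]
    exact Ideal.mem_span_singleton_self _
  · intro x hx
    rw [Ideal.mem_comap, hq, Ideal.Quotient.eq_zero_iff_mem.mpr hx]
    exact Ideal.zero_mem _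
  · intro x hx
    rw [← Ideal.Quotient.eq_zero_iff_mem]
    have h1 := Ideal.mem_map_of_mem q hx
    rw [Ideal.map_pow, Ideal.map_mul, Ideal.map_comap_of_surjective q hqs, mul_pow] at h1
    have h2 := Ideal.mul_mono hs (Ideal.pow_le_self (I := Ideal.span {1 - e}) hk.ne') h1
    rw [Ideal.span_singleton_mul_span_singleton, he] at h2
    simpa using h2

open IsLocalRing

lemma nqf_local {A B R : Type*} [CommRing A] [CommRing B] [CommRing R] [IsLocalRing A]
    [IsLocalRing R]
    [Algebra A B] [Module.Finite A B] [IsDomain B] [Algebra B R]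
    [IsDomain A] [IsIntegrallyClosed A] (hinj : Function.Injective (algebraMap A B))
    (n : Ideal B) [n.IsMaximal] [IsLocalization.AtPrime R n]
    (hS : IsQFactorialRing (AdicCompletion (maximalIdeal R) R)) :
    IsQFactorialRing (AdicCompletion (maximalIdeal A) A) := by
  have hn : n.comap (algebraMap A B) = maximalIdeal A := by
    have := Ideal.isMaximal_comap_of_isIntegral_of_isMaximal (R := A) n
    exact eq_maximalIdeal this
  obtain ⟨o, n0, hn0, hno, ho, hpow⟩ := nqf_exists_compl (maximalIdeal A) n
  let g : A →+* R := (algebraMap B R).comp (algebraMap A B)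
  have hg : maximalIdeal A ≤ (maximalIdeal R).comap g := by
    rw [← Ideal.comap_comap, ← hn]
    refine Ideal.comap_mono ?_
    exact (IsLocalization.AtPrime.under_maximalIdeal R n).ge
  have hgk : ∀ k, maximalIdeal A ^ k ≤ (maximalIdeal R ^ k).comap g := fun k =>
    (Ideal.pow_right_mono hg k).trans (Ideal.le_comap_pow g k)
  let E := fun k => IsLocalization.AtPrime.equivQuotMaximalIdealPow n R k
  let F : ∀ k, AdicCompletion (maximalIdeal A) A →+* R ⧸ maximalIdeal R ^ k := fun k =>
    (Ideal.quotientMap (maximalIdeal R ^ k) g (hgk k)).comp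
      (AdicCompletion.evalₐ (maximalIdeal A) k : _ →+* _)
  have hFa : ∀ k r a, AdicCompletion.evalₐ (maximalIdeal A) k r = Ideal.Quotient.mk _ a →
      F k r = Ideal.Quotient.mk _ (g a) := by
    intro k r a h
    simp only [F, RingHom.comp_apply, RingHom.coe_coe]
    rw [h, Ideal.quotientMap_mk]
  have hF : ∀ {k l : ℕ} (hle : k ≤ l),
      (Ideal.Quotient.factorPow (maximalIdeal R) hle).comp (F l) = F k := by
    intro k l hle
    ext r
    obtain ⟨a, ha⟩ := Ideal.Quotient.mk_surjective (AdicCompletion.evalₐ (maximalIdeal A) l r)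
    rw [RingHom.comp_apply, hFa l r a ha.symm, hFa k r a (nqf_eval_mono _ _ hle _ ha.symm)]
    rfl
  let φ := AdicCompletion.liftRingHom (maximalIdeal R) F hF
  let π : ∀ k, AdicCompletion (maximalIdeal R) R →+* B ⧸ n ^ k := fun k =>
    ((E k).symm : (R ⧸ maximalIdeal R ^ k) →+* (B ⧸ n ^ k)).comp (AdicCompletion.evalₐ (maximalIdeal R) k : _ →+* _)
  have hπE : ∀ k s b, π k s = Ideal.Quotient.mk _ b ↔
      AdicCompletion.evalₐ (maximalIdeal R) k s = Ideal.Quotient.mk _ (algebraMap B R b) := by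
    intro k s b
    simp only [π, RingHom.comp_apply, RingHom.coe_coe]
    rw [← IsLocalization.AtPrime.equivQuotMaximalIdealPow_apply_mk n R]
    exact (E k).symm_apply_eq
  refine nqf_complete hinj (maximalIdeal A) n o hn hno ho n0 hn0 hpow π ?_ ?_ φ ?_ hS
  · intro s hs
    refine AdicCompletion.ext_evalₐ fun k => ?_
    have := (hπE k s 0).mp (by rw [hs, map_zero])
    rw [this, map_zero, map_zero, map_zero]
  · intro k l s b hkl h
    rw [hπE] at h ⊢
    exact nqf_eval_mono _ _ hkl _ h
  · intro k r a h
    rw [hπE, AdicCompletion.evalₐ_liftRingHom]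
    exact hFa k r a h

lemma nqf_semilocal {A₀ B₀ A R : Type*} [CommRing A₀] [CommRing B₀] [CommRing A] [CommRing R]
    [Algebra A₀ B₀] [Module.Finite A₀ B₀] [IsDomain B₀]
    (hinj : Function.Injective (algebraMap A₀ B₀))
    (p : Ideal A₀) [p.IsPrime] (P : Ideal B₀) [P.IsPrime]
    (hP : P.comap (algebraMap A₀ B₀) = p)
    [Algebra A₀ A] [IsLocalization.AtPrime A p] [Algebra B₀ R] [IsLocalization.AtPrime R P]
    [IsLocalRing A] [IsLocalRing R] [IsDomain A] [IsIntegrallyClosed A]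
    (hS : IsQFactorialRing (AdicCompletion (maximalIdeal R) R)) :
    IsQFactorialRing (AdicCompletion (maximalIdeal A) A) := by
  let M : Submonoid B₀ := Algebra.algebraMapSubmonoid B₀ p.primeCompl
  have hMP : M ≤ P.primeCompl := by
    rintro _ ⟨a, ha, rfl⟩ h
    exact ha (by rw [← hP]; exact h)
  have hM0 : M ≤ nonZeroDivisors B₀ := hMP.trans P.primeCompl_le_nonZeroDivisors
  let B := Localization M
  have : IsDomain B := IsLocalization.isDomain_localization hM0
  let : Algebra A B := localizationAlgebra p.primeCompl B₀
  have hunit : ∀ y : M, IsUnit (algebraMap B₀ R y) := fun y =>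
    IsLocalization.map_units R (⟨y, hMP y.2⟩ : P.primeCompl)
  let : Algebra B R := (IsLocalization.lift (M := M) (S := B) hunit).toAlgebra
  have : IsScalarTower B₀ B R := IsScalarTower.of_algebraMap_eq fun b =>
    (IsLocalization.lift_eq hunit b).symm
  have : IsScalarTower A₀ A B := IsScalarTower.of_algebraMap_eq fun a =>
    (IsLocalization.map_eq (S := A) (Q := B) (T := M) (g := algebraMap A₀ B₀)
      (Submonoid.le_comap_map p.primeCompl) a).symm
  have : Module.Finite A B := Module.Finite.of_isLocalization A₀ B₀ p.primeCompl
  have hinj' : Function.Injective (algebraMap A B) := by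
    have hloc0 : IsLocalization (p.primeCompl.map (algebraMap A₀ B₀)) B :=
      inferInstanceAs (IsLocalization M (Localization M))
    have := IsLocalization.map_injective_of_injective p.primeCompl A B (g := algebraMap A₀ B₀) hinj
    exact this
  let n : Ideal B := (maximalIdeal R).comap (algebraMap B R)
  have hnprime : n.IsPrime := Ideal.IsPrime.comap _
  have hnA : n.comap (algebraMap A B) = maximalIdeal A := by
    have h1 : (n.comap (algebraMap A B)).comap (algebraMap A₀ A) = p := by
      rw [Ideal.comap_comap, ← IsScalarTower.algebraMap_eq A₀ A B,
        IsScalarTower.algebraMap_eq A₀ B₀ B, ← Ideal.comap_comap, ← hP]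
      congr 1
      simp only [n]
      rw [Ideal.comap_comap, ← IsScalarTower.algebraMap_eq B₀ B R]
      exact IsLocalization.AtPrime.under_maximalIdeal R P
    have h2 : (maximalIdeal A).comap (algebraMap A₀ A) = p :=
      IsLocalization.AtPrime.under_maximalIdeal A p
    rw [← IsLocalization.map_under p.primeCompl A (n.comap (algebraMap A B)),
      ← IsLocalization.map_under p.primeCompl A (maximalIdeal A)]
    rw [Ideal.under_def, Ideal.under_def, h1, h2]
  have : n.IsMaximal := by
    refine Ideal.isMaximal_of_isIntegral_of_isMaximal_comap (R := A) n ?_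
    rw [hnA]; exact maximalIdeal.isMaximal A
  have hloc := IsLocalization.isLocalization_of_submonoid_le B R M P.primeCompl hMP
  have : IsLocalization.AtPrime R n := by
    refine IsLocalization.of_le (P.primeCompl.map (algebraMap B₀ B)) n.primeCompl ?_ ?_
    · rintro _ ⟨b, hb, rfl⟩ h
      refine hb ?_
      rw [← IsLocalization.AtPrime.under_maximalIdeal R P, Ideal.under_def]
      change algebraMap B₀ R b ∈ maximalIdeal R
      rw [IsScalarTower.algebraMap_apply B₀ B R]
      exact h
    · intro r hr
      by_contra h
      exact hr ((mem_maximalIdeal _).mpr h)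
  exact nqf_local hinj' n hS

end PartFour

theorem preimage_NQF_subset_NQF
    (X Y : Scheme) [IsIntegral X] [IsIntegral Y]
    (hX : IsNormalScheme X) (hY : IsNormalScheme Y)
    (f : X ⟶ Y) [IsFinite f] (hsurj : Function.Surjective f.base) :
    f.base ⁻¹' NQF Y ⊆ NQF X := by
  intro x hx hq
  refine hx ?_
  change IsQFactorialRing (completedStalk X x) at hq
  change IsQFactorialRing (completedStalk Y (f x))
  obtain ⟨_, ⟨V, hV, rfl⟩, hxV, -⟩ := Y.isBasis_affineOpens.exists_subset_of_mem_open
    (Set.mem_univ (f x)) isOpen_univ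
  have hxU : x ∈ f ⁻¹ᵁ V := hxV
  have hU : IsAffineOpen (f ⁻¹ᵁ V) := hV.preimage f
  have : Nonempty (f ⁻¹ᵁ V) := ⟨⟨x, hxU⟩⟩
  have : Nonempty V := ⟨⟨f x, hxV⟩⟩
  let : Algebra Γ(Y, V) Γ(X, f ⁻¹ᵁ V) := (f.app V).hom.toAlgebra
  have : Module.Finite Γ(Y, V) Γ(X, f ⁻¹ᵁ V) := IsFinite.finite_app f V hV
  let := Y.presheaf.algebra_section_stalk ⟨f x, hxV⟩
  have hl1 := hV.isLocalization_stalk ⟨f x, hxV⟩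
  let := X.presheaf.algebra_section_stalk ⟨x, hxU⟩
  have hl2 := hU.isLocalization_stalk ⟨x, hxU⟩
  have := (hY (f x)).1
  have := (hY (f x)).2
  have hinj : Function.Injective (algebraMap Γ(Y, V) Γ(X, f ⁻¹ᵁ V)) := by
    rw [injective_iff_map_eq_zero]
    intro a ha
    have hb : Y.basicOpen a = ⊥ := by
      ext y
      simp only [TopologicalSpace.Opens.coe_bot, Set.mem_empty_iff_false, iff_false]
      intro hy
      obtain ⟨z, rfl⟩ := hsurj y
      have h1 : z ∈ f ⁻¹ᵁ Y.basicOpen a := hy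
      rw [Scheme.preimage_basicOpen] at h1
      have h2 : f.app V a = 0 := ha
      rw [h2, Scheme.basicOpen_zero] at h1
      exact h1
    exact (basicOpen_eq_bot_iff a).mp hb
  have hcomap := IsAffineOpen.comap_primeIdealOf_appLE V hV (f ⁻¹ᵁ V) hU le_rfl hxU
  exact nqf_semilocal hinj (hV.primeIdealOf ⟨f x, hxV⟩).asIdeal (hU.primeIdealOf ⟨x, hxU⟩).asIdeal
    (by
      have := congrArg PrimeSpectrum.asIdeal hcomap
      rw [← this, ← Scheme.Hom.app_eq_appLE]
      rfl) hq
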